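/- arXiv:1106.0867 — 2 statements merged into one kernel-verified Lean document; each statement's English description precedes it below -/
import Mathlib

section
/- Let Δ be the tetrahedral group [3,5,3]⁺. Then Δ has exactly one normal subgroup K such that the quotient Δ/K is isomorphic to PSL(2, F₁₆); moreover, for every positive integer n with n ≠ 4, Δ has no normal subgroup K with Δ/K isomorphic to PSL(2, F_{2^n}). -/
/-- The relators of the tetrahedral group `Δ = [3,5,3]⁺`, on generators
`α = of 0`, `β = of 1`, `γ = of 2`:
`α³, β⁵, γ³, (αβ)², (βγ)², (αβγ)²`. -/
def tetRelators : Set (FreeGroup (Fin 3)) :=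
  { FreeGroup.of 0 ^ 3, FreeGroup.of 1 ^ 5, FreeGroup.of 2 ^ 3,
    (FreeGroup.of 0 * FreeGroup.of 1) ^ 2, (FreeGroup.of 1 * FreeGroup.of 2) ^ 2,
    (FreeGroup.of 0 * FreeGroup.of 1 * FreeGroup.of 2) ^ 2 }

/-- The tetrahedral group `Δ = [3,5,3]⁺` as a presented group. -/
abbrev Tet : Type := PresentedGroup tetRelators

/-- `K` is a normal subgroup of `Δ` with `Δ/K ≅ PSL(2, F)`, expressed as: `K` is the kernel of
a surjective homomorphism `Δ →* PSL(2, F)`. -/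
def IsPSLQuotient (F : Type) [Field F] (K : Subgroup Tet) : Prop :=
  ∃ f : Tet →* Matrix.ProjectiveSpecialLinearGroup (Fin 2) F,
    Function.Surjective f ∧ f.ker = K

open Matrix

theorem of_fin_two_congr {R : Type} {a b c d a' b' c' d' : R} (ha : a = a') (hb : b = b')
    (hc : c = c') (hd : d = d') : !![a, b; c, d] = !![a', b'; c', d'] := by
  rw [ha, hb, hc, hd]

theorem relations_map {G : Type} [Group G] (f : Tet →* G) :
    f (.of 0) ^ 3 = 1 ∧ f (.of 1) ^ 5 = 1 ∧ f (.of 2) ^ 3 = 1 ∧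
    (f (.of 0) * f (.of 1)) ^ 2 = 1 ∧ (f (.of 1) * f (.of 2)) ^ 2 = 1 ∧
    (f (.of 0) * f (.of 1) * f (.of 2)) ^ 2 = 1 := by
  have key : ∀ r ∈ tetRelators, f (PresentedGroup.mk tetRelators r) = 1 := fun r hr => by
    rw [PresentedGroup.one_of_mem hr, map_one]
  refine ⟨?_, ?_, ?_, ?_, ?_, ?_⟩ <;> simp only [← map_mul, ← map_pow] <;>
    exact key _ (by simp [tetRelators])

/-- A nontrivial homomorphism from `Δ` kills none of the generators. -/
theorem map_of_ne_one {G : Type} [Group G] (f : Tet →* G) (hf : f ≠ 1) (i : Fin 3) :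
    f (.of i) ≠ 1 := by
  obtain ⟨ha, hb, hc, hab, hbc, habc⟩ := relations_map f
  intro hi
  have of_sq_cube : ∀ x : G, x ^ 2 = 1 → x ^ 3 = 1 → x = 1 := fun x h2 h3 => by
    rwa [pow_succ, h2, one_mul] at h3
  have hb1 : f (.of 1) = 1 := by
    have of_sq : f (.of 1) ^ 2 = 1 → f (.of 1) = 1 := fun h => by
      rwa [show 5 = 2 * 2 + 1 from rfl, pow_succ, pow_mul, h, one_pow, one_mul] at hb
    fin_cases i
    · exact of_sq (by simpa [show f (.of 0) = 1 from hi] using hab)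
    · exact hi
    · exact of_sq (by simpa [show f (.of 2) = 1 from hi] using hbc)
  refine hf (PresentedGroup.ext fun j => ?_)
  rw [MonoidHom.one_apply]
  fin_cases j
  · exact of_sq_cube _ (by simpa [hb1] using hab) ha
  · exact hb1
  · exact of_sq_cube _ (by simpa [hb1] using hbc) hc

section Field

variable {F : Type} [Field F]

/-- The upper unipotent matrix with off-diagonal entry `x`. -/
def upperUnipotent (x : F) : Matrix.SpecialLinearGroup (Fin 2) F :=
  ⟨!![1, x; 0, 1], by simp⟩

/-- The lower unipotent matrix with off-diagonal entry `x`. -/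
def lowerUnipotent (x : F) : Matrix.SpecialLinearGroup (Fin 2) F :=
  ⟨!![1, 0; x, 1], by simp⟩

theorem coe_upperUnipotent (x : F) :
    (upperUnipotent x : Matrix (Fin 2) (Fin 2) F) = !![1, x; 0, 1] := rfl

theorem coe_lowerUnipotent (x : F) :
    (lowerUnipotent x : Matrix (Fin 2) (Fin 2) F) = !![1, 0; x, 1] := rfl

/-- `SL(2, F)` is generated by its unipotent upper and lower triangular matrices. -/
theorem eq_top_of_unipotent_mem (H : Subgroup (Matrix.SpecialLinearGroup (Fin 2) F))
    (hU : ∀ x, upperUnipotent x ∈ H) (hL : ∀ x, lowerUnipotent x ∈ H) : H = ⊤ := by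
  have main : ∀ g : Matrix.SpecialLinearGroup (Fin 2) F, g 1 0 ≠ 0 → g ∈ H := by
    intro g hg
    have hdet := g.det_coe
    rw [det_fin_two] at hdet
    have : g = upperUnipotent ((g 0 0 - 1) / g 1 0) * lowerUnipotent (g 1 0) *
        upperUnipotent ((g 1 1 - 1) / g 1 0) := by
      ext i j
      simp only [Matrix.SpecialLinearGroup.coe_mul, coe_upperUnipotent, coe_lowerUnipotent,
        mul_fin_two]
      fin_cases i <;> fin_cases j <;> simp <;> field_simp <;> grind
    rw [this]
    exact H.mul_mem (H.mul_mem (hU _) (hL _)) (hU _)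
  rw [eq_top_iff]
  intro g _
  by_cases hg : g 1 0 = 0
  · have hdet := g.det_coe
    rw [det_fin_two, hg] at hdet
    refine (H.mul_mem_cancel_left (hL 1)).mp (main _ ?_)
    have : (lowerUnipotent 1 * g : Matrix.SpecialLinearGroup (Fin 2) F) 1 0 = g 0 0 := by
      simp [coe_lowerUnipotent, Matrix.mul_apply, hg]
    rw [this]
    intro h0
    simp [h0] at hdet
  · exact main g hg

/-- The second generator of the normal form, with parameter `k`. -/
def normalB (k : F) : Matrix.SpecialLinearGroup (Fin 2) F :=
  ⟨!![1, 1; k ^ 2 + k, k ^ 2 + k + 1], by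
    rw [det_fin_two_of]; ring⟩

theorem coe_normalB (k : F) :
    (normalB k : Matrix (Fin 2) (Fin 2) F) = !![1, 1; k ^ 2 + k, k ^ 2 + k + 1] := rfl

/-- Conjugation by an invertible matrix, as an endomorphism of the special linear group. -/
def conjHom (P Q : Matrix (Fin 2) (Fin 2) F) (h : P * Q = 1) :
    Matrix.SpecialLinearGroup (Fin 2) F →* Matrix.SpecialLinearGroup (Fin 2) F where
  toFun M := ⟨Q * M * P, by
    rw [det_mul, det_mul, M.det_coe, mul_one, mul_comm, ← det_mul, h, det_one]⟩
  map_one' := Subtype.ext (by simpa using mul_eq_one_comm.mp h)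
  map_mul' M N := Subtype.ext (by
    change Q * (M * N) * P = Q * M * P * (Q * N * P)
    simp only [Matrix.mul_assoc]
    rw [← Matrix.mul_assoc P Q, h, Matrix.one_mul])

theorem coe_conjHom (P Q : Matrix (Fin 2) (Fin 2) F) (h : P * Q = 1)
    (M : Matrix.SpecialLinearGroup (Fin 2) F) :
    (conjHom P Q h M : Matrix (Fin 2) (Fin 2) F) = Q * M * P := rfl

theorem conjHom_injective (P Q : Matrix (Fin 2) (Fin 2) F) (h : P * Q = 1) :
    Function.Injective (conjHom P Q h) := by
  intro M N hMN
  have hc : Q * (M : Matrix (Fin 2) (Fin 2) F) * P = Q * N * P := congrArg Subtype.val hMN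
  have key : ∀ X : Matrix (Fin 2) (Fin 2) F, P * (Q * X * P) * Q = X := fun X => by
    rw [Matrix.mul_assoc Q, ← Matrix.mul_assoc P, h, Matrix.one_mul, Matrix.mul_assoc, h,
      Matrix.mul_one]
  apply Subtype.ext
  rw [← key M, hc, key]

theorem trace_conjHom (P Q : Matrix (Fin 2) (Fin 2) F) (h : P * Q = 1)
    (M : Matrix.SpecialLinearGroup (Fin 2) F) :
    (conjHom P Q h M : Matrix (Fin 2) (Fin 2) F).trace = (M : Matrix (Fin 2) (Fin 2) F).trace := by
  rw [coe_conjHom, Matrix.mul_assoc, trace_mul_comm, Matrix.mul_assoc, h, Matrix.mul_one]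

theorem ne_one_of_surjective {f : Tet →* Matrix.SpecialLinearGroup (Fin 2) F}
    (hf : Function.Surjective f) : f ≠ 1 := by
  rintro rfl
  obtain ⟨g, hg⟩ := hf (upperUnipotent 1)
  have := congrArg (fun M : Matrix.SpecialLinearGroup (Fin 2) F => M 0 1) hg
  simp [coe_upperUnipotent] at this

variable [CharP F 2]

/-- In characteristic two the center of `SL(2, F)` is trivial. -/
theorem center_specialLinearGroup_eq_bot :
    Subgroup.center (Matrix.SpecialLinearGroup (Fin 2) F) = ⊥ := by
  rw [eq_bot_iff]
  intro g hg
  obtain ⟨r, hr, hg⟩ := Matrix.SpecialLinearGroup.mem_center_iff.mp hg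
  have h2 : (2 : F) = 0 := CharTwo.two_eq_zero
  have hr1 : r = 1 := by
    have : (r + 1) ^ 2 = 0 := by
      simp only [Fintype.card_fin] at hr
      linear_combination hr + (r + 1) * h2
    have := pow_eq_zero_iff (two_ne_zero) |>.mp this
    linear_combination this - h2
  rw [Subgroup.mem_bot]
  ext i j
  rw [← hg, hr1]
  simp

/-- The first generator of the normal form, with parameter `k`. -/
def normalA (k : F) (h : k ^ 4 = k + 1) : Matrix.SpecialLinearGroup (Fin 2) F :=
  ⟨!![k ^ 2 + k, 0; 0, k ^ 2 + k + 1], by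
    have h2 : (2 : F) = 0 := CharTwo.two_eq_zero
    rw [det_fin_two_of]; grind only⟩

theorem coe_normalA (k : F) (h : k ^ 4 = k + 1) :
    ((normalA k h : Matrix.SpecialLinearGroup (Fin 2) F) : Matrix (Fin 2) (Fin 2) F) =
      !![k ^ 2 + k, 0; 0, k ^ 2 + k + 1] := rfl

/-- The third generator of the normal form, with parameter `k`. -/
def normalC (k : F) (h : k ^ 4 = k + 1) : Matrix.SpecialLinearGroup (Fin 2) F :=
  ⟨!![k, (k ^ 2 + k) * (1 + k); k, 1 + k], by
    have h2 : (2 : F) = 0 := CharTwo.two_eq_zero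
    rw [det_fin_two_of]; grind only⟩

theorem coe_normalC (k : F) (h : k ^ 4 = k + 1) :
    ((normalC k h : Matrix.SpecialLinearGroup (Fin 2) F) : Matrix (Fin 2) (Fin 2) F) =
      !![k, (k ^ 2 + k) * (1 + k); k, 1 + k] := rfl

theorem normal_relators (k : F) (h : k ^ 4 = k + 1) :
    ∀ r ∈ tetRelators, FreeGroup.lift ![normalA k h, normalB k, normalC k h] r = 1 := by
  have h2 : (2 : F) = 0 := CharTwo.two_eq_zero
  intro r hr
  simp only [tetRelators, Set.mem_insert_iff, Set.mem_singleton_iff] at hr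
  rcases hr with rfl | rfl | rfl | rfl | rfl | rfl <;>
  · simp only [map_mul, FreeGroup.lift_apply_of, pow_succ, pow_zero, one_mul,
      cons_val_zero, cons_val_one, cons_val]
    apply Subtype.ext
    simp only [Matrix.SpecialLinearGroup.coe_mul, coe_normalA, coe_normalB, coe_normalC,
      mul_fin_two, Matrix.SpecialLinearGroup.coe_one, one_fin_two]
    refine of_fin_two_congr ?_ ?_ ?_ ?_ <;> grind only

/-- The representation of `Δ` attached to a root `k` of `X⁴ + X + 1`. -/
def normalRep (k : F) (h : k ^ 4 = k + 1) : Tet →* Matrix.SpecialLinearGroup (Fin 2) F :=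
  PresentedGroup.toGroup (normal_relators k h)

theorem normalRep_of (k : F) (h : k ^ 4 = k + 1) (i : Fin 3) :
    normalRep k h (PresentedGroup.of i) = ![normalA k h, normalB k, normalC k h] i :=
  PresentedGroup.toGroup.of _

theorem map_comp_normalRep (σ : F →+* F) (k : F) (h : k ^ 4 = k + 1)
    (h' : σ k ^ 4 = σ k + 1) :
    (Matrix.SpecialLinearGroup.map σ).comp (normalRep k h) = normalRep (σ k) h' := by
  refine PresentedGroup.ext fun i => ?_
  rw [MonoidHom.comp_apply, normalRep_of, normalRep_of]
  fin_cases i <;> ext a b <;> fin_cases a <;> fin_cases b <;>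
    simp [coe_normalA, coe_normalB, coe_normalC]

theorem ker_normalRep_map (σ : F →+* F) (k : F) (h : k ^ 4 = k + 1)
    (h' : σ k ^ 4 = σ k + 1) : (normalRep (σ k) h').ker = (normalRep k h).ker := by
  rw [← map_comp_normalRep σ k h h']
  refine MonoidHom.ker_comp_of_injective _ _ ?_
  intro A B hAB
  ext i j
  have := congrArg (fun M : Matrix.SpecialLinearGroup (Fin 2) F =>
    (M : Matrix (Fin 2) (Fin 2) F) i j) hAB
  exact σ.injective (by simpa using this)

/-- The roots of `X⁴ + X + 1` are permuted transitively by Frobenius. -/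
theorem exists_iterateFrobenius_eq (k l : F) (hk : k ^ 4 = k + 1) (hl : l ^ 4 = l + 1) :
    ∃ j, iterateFrobenius F 2 j k = l := by
  have h2 : (2 : F) = 0 := CharTwo.two_eq_zero
  have key : (l - k) * (l - k ^ 2) * (l - k ^ 4) * (l - k ^ 8) = 0 := by grind only
  rcases mul_eq_zero.mp key with key | key
  · rcases mul_eq_zero.mp key with key | key
    · rcases mul_eq_zero.mp key with key | key
      · exact ⟨0, by rw [iterateFrobenius_def]; simpa using (sub_eq_zero.mp key).symm⟩
      · exact ⟨1, by rw [iterateFrobenius_def]; exact (sub_eq_zero.mp key).symm⟩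
    · exact ⟨2, by rw [iterateFrobenius_def]; exact (sub_eq_zero.mp key).symm⟩
  · exact ⟨3, by rw [iterateFrobenius_def]; exact (sub_eq_zero.mp key).symm⟩

theorem ker_normalRep_eq (k l : F) (hk : k ^ 4 = k + 1) (hl : l ^ 4 = l + 1) :
    (normalRep k hk).ker = (normalRep l hl).ker := by
  obtain ⟨j, rfl⟩ := exists_iterateFrobenius_eq k l hk hl
  exact (ker_normalRep_map _ k hk hl).symm

theorem trace_normalRep_pow (k : F) (h : k ^ 4 = k + 1) (g : Tet) :
    (normalRep k h g : Matrix (Fin 2) (Fin 2) F).trace ^ 16 =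
      (normalRep k h g : Matrix (Fin 2) (Fin 2) F).trace := by
  have h2 : (2 : F) = 0 := CharTwo.two_eq_zero
  have hk : iterateFrobenius F 2 4 k = k := by
    rw [iterateFrobenius_def]; norm_num; grind only
  have hcomp := map_comp_normalRep (iterateFrobenius F 2 4) k h (by rw [hk]; exact h)
  have hg := DFunLike.congr_fun hcomp g
  simp only [hk, MonoidHom.comp_apply] at hg
  have ht := congrArg (fun M : Matrix.SpecialLinearGroup (Fin 2) F =>
    (M : Matrix (Fin 2) (Fin 2) F).trace) hg
  have hpow : ∀ x : F, iterateFrobenius F 2 4 x = x ^ 16 := fun x => by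
    rw [iterateFrobenius_def]; norm_num
  rw [← hpow]
  simpa only [trace_fin_two, map_add] using! ht

theorem normalRep_surjective (k : F) (h : k ^ 4 = k + 1) (hF : ∀ x : F, x ^ 16 = x) :
    Function.Surjective (normalRep k h) := by
  have h2 : (2 : F) = 0 := CharTwo.two_eq_zero
  rw [← MonoidHom.range_eq_top]
  set H := (normalRep k h).range with hH
  have hA : normalA k h ∈ H := ⟨_, normalRep_of k h 0⟩
  have hB : normalB k ∈ H := ⟨_, normalRep_of k h 1⟩
  have hC : normalC k h ∈ H := ⟨_, normalRep_of k h 2⟩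
  have hadd : ∀ x y, upperUnipotent x ∈ H → upperUnipotent y ∈ H →
      upperUnipotent (x + y) ∈ H := by
    intro x y hx hy
    have : upperUnipotent (x + y) = upperUnipotent x * upperUnipotent y := by
      apply Subtype.ext
      simp only [Matrix.SpecialLinearGroup.coe_mul, coe_upperUnipotent, mul_fin_two]
      refine of_fin_two_congr ?_ ?_ ?_ ?_ <;> ring
    rw [this]
    exact H.mul_mem hx hy
  have hmul : ∀ x, upperUnipotent x ∈ H → upperUnipotent ((k ^ 2 + k) * x) ∈ H := by
    intro x hx
    have : upperUnipotent ((k ^ 2 + k) * x) =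
        (normalA k h)⁻¹ * upperUnipotent x * normalA k h := by
      apply Subtype.ext
      simp only [Matrix.SpecialLinearGroup.coe_mul, Matrix.SpecialLinearGroup.coe_inv,
        adjugate_fin_two_of, coe_upperUnipotent, coe_normalA, mul_fin_two]
      refine of_fin_two_congr ?_ ?_ ?_ ?_ <;> grind only
    rw [this]
    exact H.mul_mem (H.mul_mem (H.inv_mem hA) hx) hA
  have hone : upperUnipotent 1 ∈ H := by
    have : upperUnipotent (k ^ 2 + k + 1) = normalB k * normalA k h * (normalB k)⁻¹ *
        normalA k h * (normalB k)⁻¹ := by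
      apply Subtype.ext
      simp only [Matrix.SpecialLinearGroup.coe_mul, Matrix.SpecialLinearGroup.coe_inv,
        adjugate_fin_two_of, coe_upperUnipotent, coe_normalA, coe_normalB, mul_fin_two]
      refine of_fin_two_congr ?_ ?_ ?_ ?_ <;> grind only
    have hmem : upperUnipotent (k ^ 2 + k + 1) ∈ H := by
      rw [this]
      exact H.mul_mem (H.mul_mem (H.mul_mem (H.mul_mem hB hA) (H.inv_mem hB)) hA) (H.inv_mem hB)
    convert hmul _ hmem using 2
    grind only
  have hk : upperUnipotent k ∈ H := by
    have : upperUnipotent (k ^ 2 + 1) = (normalC k h)⁻¹ * normalB k * normalA k h *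
        normalC k h := by
      apply Subtype.ext
      simp only [Matrix.SpecialLinearGroup.coe_mul, Matrix.SpecialLinearGroup.coe_inv,
        adjugate_fin_two_of, coe_upperUnipotent, coe_normalA, coe_normalB, coe_normalC, mul_fin_two]
      refine of_fin_two_congr ?_ ?_ ?_ ?_ <;> grind only
    have hmem : upperUnipotent (k ^ 2 + 1) ∈ H := by
      rw [this]
      exact H.mul_mem (H.mul_mem (H.mul_mem (H.inv_mem hC) hB) hA) hC
    convert hadd _ _ hmem (hadd _ _ (hmul _ hone) hone) using 2
    grind only
  have hquad : ∀ y x : F, y ^ 4 = y → upperUnipotent x ∈ H → upperUnipotent (y * x) ∈ H := by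
    intro y x hy hx
    have key : y * (y - 1) * (y - (k ^ 2 + k)) * (y - (k ^ 2 + k + 1)) = 0 := by grind only
    simp only [mul_eq_zero, sub_eq_zero] at key
    rcases key with ((rfl | rfl) | rfl) | rfl
    · rw [zero_mul]
      have : upperUnipotent (0 : F) = 1 := by
        ext i j
        fin_cases i <;> fin_cases j <;> simp [upperUnipotent]
      rw [this]
      exact H.one_mem
    · rwa [one_mul]
    · exact hmul x hx
    · rw [add_mul, one_mul]
      exact hadd _ _ (hmul x hx) hx
  have hU : ∀ x, upperUnipotent x ∈ H := by
    intro x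
    have hx := hF x
    have hdecomp : x = (x ^ 4 + x) * k + (x + (x ^ 4 + x) * k) * 1 := by grind only
    rw [hdecomp]
    refine hadd _ _ (hquad _ _ ?_ hk) (hquad _ _ ?_ hone)
    · grind only
    · grind only
  refine eq_top_of_unipotent_mem H hU fun x => ?_
  set W := normalB k * normalB k * (normalA k h)⁻¹ * normalB k * normalB k *
    (normalA k h)⁻¹ * normalB k with hW
  have hWmem : W ∈ H :=
    H.mul_mem (H.mul_mem (H.mul_mem (H.mul_mem (H.mul_mem (H.mul_mem hB hB)
      (H.inv_mem hA)) hB) hB) (H.inv_mem hA)) hB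
  have hWval : (W : Matrix (Fin 2) (Fin 2) F) = !![0, 1; 1, 0] := by
    simp only [hW, Matrix.SpecialLinearGroup.coe_mul, Matrix.SpecialLinearGroup.coe_inv,
      adjugate_fin_two_of, coe_normalA, coe_normalB, mul_fin_two]
    refine of_fin_two_congr ?_ ?_ ?_ ?_ <;> grind only
  have : lowerUnipotent x = W * upperUnipotent x * W := by
    apply Subtype.ext
    simp only [Matrix.SpecialLinearGroup.coe_mul, hWval, coe_upperUnipotent, coe_lowerUnipotent,
      mul_fin_two]
    refine of_fin_two_congr ?_ ?_ ?_ ?_ <;> ring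
  rw [this]
  exact H.mul_mem (H.mul_mem hWmem (hU x)) hWmem

theorem sq_eq_trace_smul_add_one (M : Matrix.SpecialLinearGroup (Fin 2) F) :
    (M : Matrix (Fin 2) (Fin 2) F) ^ 2 = (M 0 0 + M 1 1) • (M : Matrix (Fin 2) (Fin 2) F) + 1 := by
  have h2 : (2 : F) = 0 := CharTwo.two_eq_zero
  have hdet := M.det_coe
  rw [det_fin_two] at hdet
  ext i j
  fin_cases i <;> fin_cases j <;> simp [pow_two, Matrix.mul_apply] <;> grind only

/-- A scalar matrix of determinant one in characteristic two is the identity. -/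
theorem eq_one_of_smul_eq (M : Matrix.SpecialLinearGroup (Fin 2) F) {u v : F} (hu : u ≠ 0)
    (h : u • (M : Matrix (Fin 2) (Fin 2) F) = v • (1 : Matrix (Fin 2) (Fin 2) F)) : M = 1 := by
  have h2 : (2 : F) = 0 := CharTwo.two_eq_zero
  have hdet := M.det_coe
  rw [det_fin_two] at hdet
  have h00 : u * M 0 0 = v := by simpa using congrFun₂ h 0 0
  have h11 : u * M 1 1 = v := by simpa using congrFun₂ h 1 1
  have h01 : M 0 1 = 0 := by simpa [hu] using congrFun₂ h 0 1
  have h10 : M 1 0 = 0 := by simpa [hu] using congrFun₂ h 1 0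
  have heq : M 0 0 = M 1 1 := mul_left_cancel₀ hu (h00.trans h11.symm)
  have hone : M 1 1 = 1 := by
    rw [heq, h01, zero_mul, sub_zero] at hdet
    have : (M 1 1 - 1) * (M 1 1 - 1) = 0 := by grind only
    exact sub_eq_zero.mp (mul_self_eq_zero.mp this)
  ext i j
  fin_cases i <;> fin_cases j <;> simp [h01, h10, heq, hone]

theorem trace_eq_zero_of_sq_eq_one {M : Matrix.SpecialLinearGroup (Fin 2) F} (h : M ^ 2 = 1) :
    M 0 0 + M 1 1 = 0 := by
  have hsq := sq_eq_trace_smul_add_one M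
  rw [← Matrix.SpecialLinearGroup.coe_pow, h, Matrix.SpecialLinearGroup.coe_one] at hsq
  by_contra h0
  have hM := (smul_eq_zero.mp (add_eq_right.mp hsq.symm)).resolve_left h0
  have hdet := M.det_coe
  rw [hM] at hdet
  simp at hdet

theorem smul_add_smul_one_mul (M : Matrix.SpecialLinearGroup (Fin 2) F) (a b : F) :
    (a • (M : Matrix (Fin 2) (Fin 2) F) + b • (1 : Matrix (Fin 2) (Fin 2) F)) * M =
      ((M 0 0 + M 1 1) * a + b) • (M : Matrix (Fin 2) (Fin 2) F) + a • 1 := by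
  rw [add_mul, smul_mul_assoc, smul_mul_assoc, ← pow_two, sq_eq_trace_smul_add_one, one_mul]
  module

theorem trace_eq_one_of_cube_eq_one {M : Matrix.SpecialLinearGroup (Fin 2) F} (h : M ^ 3 = 1)
    (hM : M ≠ 1) : M 0 0 + M 1 1 = 1 := by
  have h2 : (2 : F) = 0 := CharTwo.two_eq_zero
  have hcube := congrArg (fun N : Matrix.SpecialLinearGroup (Fin 2) F =>
    (N : Matrix (Fin 2) (Fin 2) F)) h
  have hone : (M : Matrix (Fin 2) (Fin 2) F) =
    (1 : F) • (M : Matrix (Fin 2) (Fin 2) F) + (0 : F) • 1 := by simp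
  have hpow : (M : Matrix (Fin 2) (Fin 2) F) ^ 3 = M * M * M := by rw [pow_succ, pow_two]
  simp only [Matrix.SpecialLinearGroup.coe_pow, Matrix.SpecialLinearGroup.coe_one] at hcube
  rw [hpow] at hcube
  nth_rw 1 [hone] at hcube
  rw [smul_add_smul_one_mul, smul_add_smul_one_mul] at hcube
  generalize ht : M 0 0 + M 1 1 = t at hcube ⊢
  by_contra h1
  refine hM (eq_one_of_smul_eq M (u := t ^ 2 + 1) (v := 1 - t) (fun h0 => h1 ?_) ?_)
  · have : (t - 1) * (t - 1) = 0 := by grind only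
    exact sub_eq_zero.mp (mul_self_eq_zero.mp this)
  · linear_combination (norm := module) hcube

theorem trace_of_pow_five_eq_one {M : Matrix.SpecialLinearGroup (Fin 2) F} (h : M ^ 5 = 1)
    (hM : M ≠ 1) : (M 0 0 + M 1 1) ^ 2 + (M 0 0 + M 1 1) + 1 = 0 := by
  have h2 : (2 : F) = 0 := CharTwo.two_eq_zero
  have hfive := congrArg (fun N : Matrix.SpecialLinearGroup (Fin 2) F =>
    (N : Matrix (Fin 2) (Fin 2) F)) h
  have hone : (M : Matrix (Fin 2) (Fin 2) F) =
    (1 : F) • (M : Matrix (Fin 2) (Fin 2) F) + (0 : F) • 1 := by simp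
  have hpow : (M : Matrix (Fin 2) (Fin 2) F) ^ 5 = M * M * M * M * M := by
    simp only [pow_succ, pow_zero, one_mul]
  simp only [Matrix.SpecialLinearGroup.coe_pow, Matrix.SpecialLinearGroup.coe_one] at hfive
  rw [hpow] at hfive
  nth_rw 1 [hone] at hfive
  rw [smul_add_smul_one_mul, smul_add_smul_one_mul, smul_add_smul_one_mul,
    smul_add_smul_one_mul] at hfive
  generalize ht : M 0 0 + M 1 1 = t at hfive ⊢
  by_contra h1
  refine hM (eq_one_of_smul_eq M (u := t ^ 4 + 3 * t ^ 2 + 1) (v := 1 - t ^ 3 - 2 * t)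
    (fun h0 => h1 ?_) ?_)
  · have : (t ^ 2 + t + 1) * (t ^ 2 + t + 1) = 0 := by grind only
    exact mul_self_eq_zero.mp this
  · linear_combination (norm := module) hfive

/-- A matrix of determinant and trace one is diagonalized by a primitive cube root of unity. -/
theorem exists_diagonalize (A : Matrix.SpecialLinearGroup (Fin 2) F) (hA : A 0 0 + A 1 1 = 1)
    {w : F} (hw : w ^ 2 + w + 1 = 0) :
    ∃ (P Q : Matrix (Fin 2) (Fin 2) F) (h : P * Q = 1),
      (conjHom P Q h A : Matrix (Fin 2) (Fin 2) F) = !![w, 0; 0, w + 1] := by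
  have h2 : (2 : F) = 0 := CharTwo.two_eq_zero
  have hdet := A.det_coe
  rw [det_fin_two] at hdet
  suffices ∃ p q r s : F, p * s - q * r ≠ 0 ∧
      (A : Matrix (Fin 2) (Fin 2) F) * !![p, q; r, s] = !![p, q; r, s] * !![w, 0; 0, w + 1] by
    obtain ⟨p, q, r, s, hP, hAP⟩ := this
    have hu : IsUnit (!![p, q; r, s] : Matrix (Fin 2) (Fin 2) F).det := by
      rw [det_fin_two_of]; exact hP.isUnit
    refine ⟨!![p, q; r, s], !![p, q; r, s]⁻¹, mul_nonsing_inv _ hu, ?_⟩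
    rw [coe_conjHom, Matrix.mul_assoc, hAP, ← Matrix.mul_assoc, nonsing_inv_mul _ hu,
      Matrix.one_mul]
  rw [eta_fin_two (A : Matrix (Fin 2) (Fin 2) F)]
  simp only [mul_fin_two]
  generalize A 0 0 = p, A 0 1 = q, A 1 0 = r, A 1 1 = s at *
  by_cases hr : r = 0
  · by_cases hq : q = 0
    · have hp : (p - w) * (p - (w + 1)) = 0 := by grind only
      rcases mul_eq_zero.mp hp with hp | hp
      · refine ⟨1, 0, 0, 1, by simp, of_fin_two_congr ?_ ?_ ?_ ?_⟩ <;> grind only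
      · refine ⟨0, 1, 1, 0, by simp, of_fin_two_congr ?_ ?_ ?_ ?_⟩ <;> grind only
    · refine ⟨q, q, p + w, p + w + 1, fun h => hq ?_, of_fin_two_congr ?_ ?_ ?_ ?_⟩ <;> grind only
  · refine ⟨p + w + 1, p + w, r, r, fun h => hr ?_, of_fin_two_congr ?_ ?_ ?_ ?_⟩ <;> grind only

/-- Every nontrivial representation of `Δ` in `SL(2, F)` is conjugate to a normal form. -/
theorem exists_conj_normalRep (f : Tet →* Matrix.SpecialLinearGroup (Fin 2) F) (hf : f ≠ 1) :
    ∃ (k : F) (hk : k ^ 4 = k + 1)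
      (τ : Matrix.SpecialLinearGroup (Fin 2) F →* Matrix.SpecialLinearGroup (Fin 2) F),
      Function.Injective τ ∧
      (∀ M, (τ M : Matrix (Fin 2) (Fin 2) F).trace = (M : Matrix (Fin 2) (Fin 2) F).trace) ∧
      τ.comp f = normalRep k hk := by
  have h2 : (2 : F) = 0 := CharTwo.two_eq_zero
  obtain ⟨ha, hb, hc, hab, hbc, habc⟩ := relations_map f
  have hta := trace_eq_one_of_cube_eq_one ha (map_of_ne_one f hf 0)
  have htb := trace_of_pow_five_eq_one hb (map_of_ne_one f hf 1)
  have htc := trace_eq_one_of_cube_eq_one hc (map_of_ne_one f hf 2)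
  have htab := trace_eq_zero_of_sq_eq_one hab
  have htbc := trace_eq_zero_of_sq_eq_one hbc
  have htabc := trace_eq_zero_of_sq_eq_one habc
  obtain ⟨P, Q, hPQ, hdiag⟩ := exists_diagonalize _ hta htb
  set w := f (.of 1) 0 0 + f (.of 1) 1 1 with hw
  simp only [← trace_fin_two] at htc htab htbc htabc hw
  set σ := conjHom P Q hPQ with hσ
  rw [← trace_conjHom P Q hPQ, ← hσ] at htc htab htbc htabc hw
  simp only [map_mul, Matrix.SpecialLinearGroup.coe_mul, hdiag] at htab htbc htabc
  have hdetB := (σ (f (.of 1))).det_coe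
  have hdetC := (σ (f (.of 2))).det_coe
  obtain ⟨b, q, r, b', hB⟩ : ∃ b q r b' : F,
      (σ (f (.of 1)) : Matrix (Fin 2) (Fin 2) F) = !![b, q; r, b'] := ⟨_, _, _, _, eta_fin_two _⟩
  obtain ⟨k, l, m, n, hC⟩ : ∃ k l m n : F,
      (σ (f (.of 2)) : Matrix (Fin 2) (Fin 2) F) = !![k, l; m, n] := ⟨_, _, _, _, eta_fin_two _⟩
  simp only [hB, hC, mul_fin_two, trace_fin_two_of, det_fin_two_of]
    at htc htab htbc htabc hw hdetB hdetC
  clear_value w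
  have hb' : b' = w + 1 := by grind only
  have hb1 : b = 1 := by grind only
  have hqr : q * r = w := by grind only
  have hq : q ≠ 0 := fun h => by grind only
  have hn : n = 1 + k := by grind only
  have hl : l = q * (w * (1 + k)) := by grind only
  have hm : m * q = k := by grind only
  have hwk : w = k ^ 2 + k := by grind only
  have hk : k ^ 4 = k + 1 := by grind only
  have hD : (!![1, 0; 0, q⁻¹] : Matrix (Fin 2) (Fin 2) F) * !![1, 0; 0, q] = 1 := by
    rw [mul_fin_two, one_fin_two]
    refine of_fin_two_congr ?_ ?_ ?_ ?_ <;> simp [hq]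
  refine ⟨k, hk, (conjHom _ _ hD).comp σ, (conjHom_injective _ _ hD).comp
    (conjHom_injective P Q hPQ), fun M => ?_, PresentedGroup.ext fun i => ?_⟩
  · rw [MonoidHom.comp_apply, trace_conjHom, hσ, trace_conjHom]
  · rw [normalRep_of, MonoidHom.comp_apply, MonoidHom.comp_apply]
    apply Subtype.ext
    rw [coe_conjHom]
    fin_cases i
    · change _ * (σ (f (.of 0)) : Matrix (Fin 2) (Fin 2) F) * _ =
        (normalA k hk : Matrix (Fin 2) (Fin 2) F)
      rw [hdiag, coe_normalA, mul_fin_two, mul_fin_two]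
      refine of_fin_two_congr ?_ ?_ ?_ ?_ <;> field_simp <;> grind only
    · change _ * (σ (f (.of 1)) : Matrix (Fin 2) (Fin 2) F) * _ =
        (normalB k : Matrix (Fin 2) (Fin 2) F)
      rw [hB, coe_normalB, mul_fin_two, mul_fin_two]
      refine of_fin_two_congr ?_ ?_ ?_ ?_ <;> field_simp <;> grind only
    · change _ * (σ (f (.of 2)) : Matrix (Fin 2) (Fin 2) F) * _ =
        (normalC k hk : Matrix (Fin 2) (Fin 2) F)
      rw [hC, coe_normalC, mul_fin_two, mul_fin_two]
      refine of_fin_two_congr ?_ ?_ ?_ ?_ <;> field_simp <;> grind only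

theorem isPSLQuotient_iff (K : Subgroup Tet) :
    IsPSLQuotient F K ↔ ∃ f : Tet →* Matrix.SpecialLinearGroup (Fin 2) F,
      Function.Surjective f ∧ f.ker = K := by
  let e : Matrix.ProjectiveSpecialLinearGroup (Fin 2) F ≃* Matrix.SpecialLinearGroup (Fin 2) F :=
    (QuotientGroup.quotientMulEquivOfEq center_specialLinearGroup_eq_bot).trans
      QuotientGroup.quotientBot
  constructor
  · rintro ⟨f, hf, rfl⟩
    exact ⟨e.toMonoidHom.comp f, e.surjective.comp hf,
      MonoidHom.ker_comp_of_injective _ _ e.injective⟩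
  · rintro ⟨f, hf, rfl⟩
    exact ⟨e.symm.toMonoidHom.comp f, e.symm.surjective.comp hf,
      MonoidHom.ker_comp_of_injective _ _ e.symm.injective⟩

theorem exists_ker_eq_of_surjective {f : Tet →* Matrix.SpecialLinearGroup (Fin 2) F}
    (hf : Function.Surjective f) :
    ∃ (k : F) (hk : k ^ 4 = k + 1), f.ker = (normalRep k hk).ker := by
  obtain ⟨k, hk, τ, hτ, -, h⟩ := exists_conj_normalRep f (ne_one_of_surjective hf)
  exact ⟨k, hk, by rw [← h, MonoidHom.ker_comp_of_injective _ _ hτ]⟩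

/-- If `SL(2, F)` is a quotient of `Δ` then `F` consists of roots of `X ^ 16 - X`. -/
theorem pow_sixteen_of_surjective {f : Tet →* Matrix.SpecialLinearGroup (Fin 2) F}
    (hf : Function.Surjective f) (x : F) : x ^ 16 = x := by
  have h2 : (2 : F) = 0 := CharTwo.two_eq_zero
  obtain ⟨k, hk, τ, -, htr, h⟩ := exists_conj_normalRep f (ne_one_of_surjective hf)
  obtain ⟨g, hg⟩ := hf ⟨!![x, 1; 1, 0], by rw [det_fin_two_of]; grind only⟩
  have hx : (normalRep k hk g : Matrix (Fin 2) (Fin 2) F).trace = x := by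
    rw [← h, MonoidHom.comp_apply, htr, hg, trace_fin_two_of, add_zero]
  rw [← hx]
  exact trace_normalRep_pow k hk g

theorem exists_root_of_pow_ne (x : F) (h16 : x ^ 16 = x) (hx : x ^ 4 ≠ x) :
    ∃ k : F, k ^ 4 = k + 1 := by
  have h2 : (2 : F) = 0 := CharTwo.two_eq_zero
  have hy : x ^ 4 + x ≠ 0 := fun h => hx (by grind only)
  have hy4 : (x ^ 4 + x) ^ 4 = x ^ 4 + x := by grind only
  refine ⟨x / (x ^ 4 + x), ?_⟩
  rw [div_pow, hy4, ← sub_eq_iff_eq_add', ← sub_div, div_eq_one_iff_eq hy]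
  grind only

end Field

theorem card_le_of_forall_pow_eq_self {F : Type} [Field F] {n : ℕ} (hn : 1 < n)
    (h : ∀ x : F, x ^ n = x) : Nat.card F ≤ n := by
  classical
  have hne : (Polynomial.X ^ n - Polynomial.X : Polynomial F) ≠ 0 :=
    FiniteField.X_pow_card_sub_X_ne_zero F hn
  have hroots : (Set.univ : Set F) ⊆
      ((Polynomial.X ^ n - Polynomial.X : Polynomial F).roots.toFinset : Set F) := by
    intro x _
    simp [hne, h x]
  have hle := Set.ncard_le_ncard hroots (Finset.finite_toSet _)
  rw [Set.ncard_univ, Set.ncard_coe_finset] at hle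
  calc Nat.card F ≤ _ := hle
    _ ≤ _ := Multiset.toFinset_card_le _
    _ ≤ _ := Polynomial.card_roots' _
    _ = n := FiniteField.X_pow_card_sub_X_natDegree_eq F hn

theorem galoisField_pow_eq_self {n : ℕ} (hn : n ≠ 0) (x : GaloisField 2 n) : x ^ 2 ^ n = x := by
  have := Fintype.ofFinite (GaloisField 2 n)
  have hcard := GaloisField.card 2 n hn
  rw [Nat.card_eq_fintype_card] at hcard
  rw [← hcard, FiniteField.pow_card]

/-- The polynomial `X⁴ + X + 1` has a root in the field with sixteen elements. -/
theorem exists_root_galoisField : ∃ k : GaloisField 2 4, k ^ 4 = k + 1 := by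
  obtain ⟨x, hx⟩ : ∃ x : GaloisField 2 4, x ^ 4 ≠ x := by
    by_contra! h
    have := card_le_of_forall_pow_eq_self (by norm_num) h
    rw [GaloisField.card 2 4 (by norm_num)] at this
    norm_num at this
  exact exists_root_of_pow_ne x (by simpa using galoisField_pow_eq_self four_ne_zero x) hx

theorem stmt_0 :
    (∃! K : Subgroup Tet, IsPSLQuotient (GaloisField 2 4) K) ∧
    ∀ n : ℕ, 0 < n → n ≠ 4 →
      ∀ K : Subgroup Tet, ¬ IsPSLQuotient (GaloisField 2 n) K := by
  refine ⟨?_, fun n hn hn4 K hK => ?_⟩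
  · obtain ⟨k, hk⟩ := exists_root_galoisField
    refine ⟨(normalRep k hk).ker, (isPSLQuotient_iff _).mpr ⟨_, normalRep_surjective k hk
      fun x => by simpa using galoisField_pow_eq_self four_ne_zero x, rfl⟩, fun K hK => ?_⟩
    obtain ⟨f, hf, rfl⟩ := (isPSLQuotient_iff _).mp hK
    obtain ⟨l, hl, h⟩ := exists_ker_eq_of_surjective hf
    rw [h, ker_normalRep_eq l k hl hk]
  · have h2 : (2 : GaloisField 2 n) = 0 := CharTwo.two_eq_zero
    obtain ⟨f, hf, -⟩ := (isPSLQuotient_iff _).mp hK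
    obtain ⟨k, hk, -⟩ := exists_ker_eq_of_surjective hf
    have hcard := card_le_of_forall_pow_eq_self (by norm_num) (pow_sixteen_of_surjective hf)
    rw [GaloisField.card 2 n hn.ne'] at hcard
    have hle : n ≤ 4 := (Nat.pow_le_pow_iff_right one_lt_two).mp (hcard.trans_eq (by norm_num))
    have hkn := galoisField_pow_eq_self hn.ne' k
    have hone : (1 : GaloisField 2 n) ≠ 0 := one_ne_zero
    have hlt : n < 4 := lt_of_le_of_ne hle hn4
    interval_cases n <;> norm_num at hkn
    · exact hone (by linear_combination (k ^ 2 + k + 1) * hkn - hk)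
    · exact hone (by linear_combination hkn - hk)
    · have hsq : k ^ 2 + k + 1 = 0 := by
        linear_combination -hkn + (k ^ 4 + k + 1) * hk + (k ^ 2 + k + 1) * h2
      exact hone (by linear_combination (k ^ 2 - k) * hsq - hk)
end

section
/- Let Δ be the tetrahedral group [3,5,3]⁺. Then Δ has exactly one normal subgroup K with Δ/K isomorphic to PSL(2, F₁₁), exactly one normal subgroup K with Δ/K isomorphic to PSL(2, F₁₂₁), and for every integer n ≥ 3 no normal subgroup K with Δ/K isomorphic to PSL(2, F_{11^n}). -/
instance : Fact (Nat.Prime 11) := ⟨by norm_num⟩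

open Matrix Subgroup
open scoped MatrixGroups

/-- The projection `SL(2, K) → PSL(2, K)`. -/
abbrev toPSL (K : Type*) [CommRing K] : SL(2, K) →* PSL(2, K) :=
  QuotientGroup.mk' (center SL(2, K))

section General

variable {F K : Type*} [Field F] [Field K]

theorem mem_center_SL_two_iff {X : SL(2, F)} : X ∈ center SL(2, F) ↔ X = 1 ∨ X = -1 := by
  rw [Matrix.SpecialLinearGroup.mem_center_iff]
  constructor
  · rintro ⟨r, hr, h⟩
    have hr' : r = 1 ∨ r = -1 := by simpa using hr
    rcases hr' with rfl | rfl
    · left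
      exact Subtype.ext (by rw [← h]; simp)
    · right
      exact Subtype.ext (by rw [← h, map_neg, map_one]; rfl)
  · rintro (rfl | rfl)
    · exact ⟨1, by simp, by simp⟩
    · exact ⟨-1, by simp, by rw [map_neg, map_one]; rfl⟩

theorem toPSL_eq_one_iff {X : SL(2, F)} : toPSL F X = 1 ↔ X = 1 ∨ X = -1 := by
  rw [← mem_center_SL_two_iff]
  exact QuotientGroup.eq_one_iff X

theorem toPSL_neg (X : SL(2, F)) : toPSL F (-X) = toPSL F X := by
  have h : toPSL F (-1) = 1 := toPSL_eq_one_iff.2 (Or.inr rfl)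
  rw [← neg_one_mul, map_mul, h, one_mul]

theorem toPSL_eq_iff {X Y : SL(2, F)} : toPSL F X = toPSL F Y ↔ X = Y ∨ X = -Y := by
  constructor
  · intro h
    have h1 : toPSL F (X * Y⁻¹) = 1 := by rw [map_mul, map_inv, h, mul_inv_cancel]
    refine (toPSL_eq_one_iff.1 h1).imp mul_inv_eq_one.1 fun h2 => ?_
    rw [← neg_one_mul, ← h2, inv_mul_cancel_right]
  · rintro (rfl | rfl)
    · rfl
    · exact toPSL_neg Y

theorem toPSL_surjective : Function.Surjective (toPSL F) :=
  QuotientGroup.mk'_surjective _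

theorem SL_two_det (X : SL(2, F)) : X 0 0 * X 1 1 - X 0 1 * X 1 0 = 1 := by
  rw [← det_fin_two]
  exact X.det_coe

theorem SL_two_ext_iff {X Y : SL(2, F)} :
    X = Y ↔ (X 0 0 = Y 0 0 ∧ X 0 1 = Y 0 1) ∧ X 1 0 = Y 1 0 ∧ X 1 1 = Y 1 1 := by
  rw [Matrix.SpecialLinearGroup.ext_iff]
  simp [Fin.forall_fin_two]

theorem map_SL_two_mk (φ : K →+* F) {a b c d : K} (h : det !![a, b; c, d] = 1) :
    (Matrix.SpecialLinearGroup.map φ ⟨!![a, b; c, d], h⟩ : Matrix (Fin 2) (Fin 2) F) =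
      !![φ a, φ b; φ c, φ d] := by
  ext i j
  fin_cases i <;> fin_cases j <;> rfl

/-- `ρ : G → PSL(2, K)`, after the base change `φ`, is conjugate by `P` to `f : G → PSL(2, F)`. -/
def Intertwines {G : Type*} [Group G] (φ : K →+* F) (P : Matrix (Fin 2) (Fin 2) F)
    (ρ : G →* PSL(2, K)) (f : G →* PSL(2, F)) (x : G) : Prop :=
  ∃ (X : SL(2, K)) (Y : SL(2, F)), toPSL K X = ρ x ∧ toPSL F Y = f x ∧
    (Y : Matrix (Fin 2) (Fin 2) F) * P = P * (X.map φ : SL(2, F))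

namespace Intertwines

variable {G : Type*} [Group G] {φ : K →+* F} {P : Matrix (Fin 2) (Fin 2) F}
  {ρ : G →* PSL(2, K)} {f : G →* PSL(2, F)} {x y : G}

protected theorem one : Intertwines φ P ρ f 1 := ⟨1, 1, by simp⟩

protected theorem mul (hx : Intertwines φ P ρ f x) (hy : Intertwines φ P ρ f y) :
    Intertwines φ P ρ f (x * y) := by
  obtain ⟨X, Y, hX, hY, h⟩ := hx
  obtain ⟨X', Y', hX', hY', h'⟩ := hy
  refine ⟨X * X', Y * Y', by simp only [map_mul, hX, hX'], by simp only [map_mul, hY, hY'], ?_⟩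
  rw [map_mul, Matrix.SpecialLinearGroup.coe_mul, Matrix.SpecialLinearGroup.coe_mul,
    Matrix.mul_assoc, h', ← Matrix.mul_assoc, h, Matrix.mul_assoc]

protected theorem inv (hx : Intertwines φ P ρ f x) : Intertwines φ P ρ f x⁻¹ := by
  obtain ⟨X, Y, hX, hY, h⟩ := hx
  refine ⟨X⁻¹, Y⁻¹, by simp only [map_inv, hX], by simp only [map_inv, hY], ?_⟩
  have h1 : (↑(Y⁻¹) : Matrix (Fin 2) (Fin 2) F) * Y = 1 := by
    rw [← Matrix.SpecialLinearGroup.coe_mul, inv_mul_cancel, Matrix.SpecialLinearGroup.coe_one]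
  have h2 : ((X.map φ : SL(2, F)) : Matrix (Fin 2) (Fin 2) F) * ((X⁻¹).map φ : SL(2, F)) = 1 := by
    rw [← Matrix.SpecialLinearGroup.coe_mul, ← map_mul, mul_inv_cancel, map_one,
      Matrix.SpecialLinearGroup.coe_one]
  calc (↑(Y⁻¹) : Matrix (Fin 2) (Fin 2) F) * P
      = ↑(Y⁻¹) * (P * (X.map φ : SL(2, F))) * ((X⁻¹).map φ : SL(2, F)) := by
        rw [Matrix.mul_assoc, Matrix.mul_assoc P, h2, Matrix.mul_one]
    _ = P * ((X⁻¹).map φ : SL(2, F)) := by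
        rw [← h, ← Matrix.mul_assoc, h1, Matrix.one_mul]

theorem of_generators {ρ : Tet →* PSL(2, K)} {f : Tet →* PSL(2, F)}
    (h : ∀ i, Intertwines φ P ρ f (PresentedGroup.of i)) (x : Tet) : Intertwines φ P ρ f x :=
  PresentedGroup.generated_by _
    { carrier := {x | Intertwines φ P ρ f x}
      mul_mem' := Intertwines.mul
      one_mem' := Intertwines.one
      inv_mem' := Intertwines.inv } h x

theorem ker_eq (hP : IsUnit P) (h : ∀ x, Intertwines φ P ρ f x) : f.ker = ρ.ker := by
  ext x
  obtain ⟨X, Y, hX, hY, e⟩ := h x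
  have hinj : Function.Injective (Matrix.SpecialLinearGroup.map (n := Fin 2) φ) := fun A B hAB =>
    Matrix.SpecialLinearGroup.ext _ _ fun i j => φ.injective congr($hAB i j)
  have hneg : Matrix.SpecialLinearGroup.map φ (-1 : SL(2, K)) = -1 := by
    ext i j
    simp [Matrix.one_apply, apply_ite φ]
  rw [MonoidHom.mem_ker, MonoidHom.mem_ker, ← hX, ← hY, toPSL_eq_one_iff, toPSL_eq_one_iff]
  constructor
  · rintro (rfl | rfl)
    · left
      apply hinj
      rw [map_one]
      refine Subtype.ext (hP.mul_left_cancel ?_)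
      rw [← e]
      simp
    · right
      apply hinj
      rw [hneg]
      refine Subtype.ext (hP.mul_left_cancel ?_)
      rw [← e]
      simp
  · rintro (rfl | rfl)
    · left
      refine Subtype.ext (hP.mul_right_cancel ?_)
      rw [e]
      simp
    · right
      refine Subtype.ext (hP.mul_right_cancel ?_)
      rw [e, hneg]
      simp

theorem baseChange_surjective (hP : IsUnit P) (h : ∀ x, Intertwines φ P ρ f x)
    (hf : Function.Surjective f) : Function.Surjective φ := by
  intro a
  have hd : IsUnit P.det := (isUnit_iff_isUnit_det P).1 hP
  let Z : SL(2, F) := ⟨P * !![1, a; 0, 1] * P⁻¹, by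
    rw [det_conj hP]
    simp⟩
  obtain ⟨x, hx⟩ := hf (toPSL F Z)
  obtain ⟨X, Y, -, hY, e⟩ := h x
  rw [hx, toPSL_eq_iff] at hY
  have hZ : (Z : Matrix (Fin 2) (Fin 2) F) * P = P * !![1, a; 0, 1] := by
    change P * !![1, a; 0, 1] * P⁻¹ * P = _
    rw [Matrix.mul_assoc, nonsing_inv_mul _ hd, Matrix.mul_one]
  rcases hY with rfl | rfl
  · rw [hZ] at e
    have h2 := congr($(hP.mul_left_cancel e) 0 1)
    exact ⟨X 0 1, by simpa using h2.symm⟩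
  · rw [Matrix.SpecialLinearGroup.coe_neg, Matrix.neg_mul, hZ, ← Matrix.mul_neg] at e
    have h2 := congr($(hP.mul_left_cancel e) 0 1)
    refine ⟨-X 0 1, ?_⟩
    rw [map_neg]
    simpa [neg_eq_iff_eq_neg] using h2.symm

end Intertwines

/-- A ring isomorphism induces an isomorphism of projective special linear groups. -/
theorem exists_PSL_two_mulEquiv (e : K ≃+* F) : Nonempty (PSL(2, K) ≃* PSL(2, F)) := by
  let m : SL(2, K) ≃* SL(2, F) :=
    MonoidHom.toMulEquiv (Matrix.SpecialLinearGroup.map (e : K →+* F))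
      (Matrix.SpecialLinearGroup.map (e.symm : F →+* K)) (by ext; simp) (by ext; simp)
  refine ⟨QuotientGroup.congr _ _ m ?_⟩
  ext x
  change x ∈ Subgroup.map m.toMonoidHom _ ↔ _
  rw [Subgroup.mem_map_equiv, Subgroup.mem_center_iff, Subgroup.mem_center_iff, m.forall_congr_left]
  refine forall_congr' fun g => ?_
  rw [← m.symm.injective.eq_iff (a := g * x)]
  exact Eq.congr (map_mul m.symm g x).symm (map_mul m.symm x g).symm

theorem PSL_two_nontrivial : Nontrivial PSL(2, F) := by
  refine ⟨toPSL F (Matrix.SpecialLinearGroup.transvection (zero_ne_one' (Fin 2)) 1), 1,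
    fun h => ?_⟩
  exact one_ne_zero ((Matrix.SpecialLinearGroup.transvection_mem_center_iff
    (zero_ne_one' (Fin 2)) (1 : F)).1 ((QuotientGroup.eq_one_iff _).1 h))

theorem SL_two_mul_self (X : SL(2, F)) :
    (X * X : Matrix (Fin 2) (Fin 2) F) = X.1.trace • X.1 - 1 := by
  have h := SL_two_det X
  ext i j
  fin_cases i <;> fin_cases j <;> simp [Matrix.mul_apply, trace_fin_two] <;>
    first | linear_combination h | linear_combination -h | ring

theorem SL_two_smul_sub_mul (X : SL(2, F)) (a b : F) :
    (a • X.1 - b • 1) * X.1 = (a * X.1.trace - b) • X.1 - a • 1 := by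
  rw [Matrix.sub_mul, Matrix.smul_mul, SL_two_mul_self, Matrix.smul_mul, Matrix.one_mul]
  module

theorem SL_two_sq (X : SL(2, F)) : X.1 ^ 2 = X.1.trace • X.1 - (1 : F) • 1 := by
  rw [sq, SL_two_mul_self, one_smul]

theorem SL_two_cube (X : SL(2, F)) :
    X.1 ^ 3 = (X.1.trace ^ 2 - 1) • X.1 - X.1.trace • 1 := by
  rw [pow_succ, SL_two_sq, SL_two_smul_sub_mul]
  module

theorem SL_two_pow_five (X : SL(2, F)) :
    X.1 ^ 5 = (X.1.trace ^ 4 - 3 * X.1.trace ^ 2 + 1) • X.1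
      - (X.1.trace ^ 3 - 2 * X.1.trace) • 1 := by
  rw [pow_succ, pow_succ, SL_two_cube, SL_two_smul_sub_mul, SL_two_smul_sub_mul]
  module

theorem toPSL_eq_one_of_smul_eq {X : SL(2, F)} {a b : F} (ha : a ≠ 0)
    (h : a • X.1 = b • (1 : Matrix (Fin 2) (Fin 2) F)) : toPSL F X = 1 := by
  have h00 : a * X 0 0 = b := by simpa using congr($h 0 0)
  have h01 : X 0 1 = 0 := by simpa [ha] using congr($h 0 1)
  have h10 : X 1 0 = 0 := by simpa [ha] using congr($h 1 0)
  have h11 : a * X 1 1 = b := by simpa using congr($h 1 1)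
  have he : X 0 0 = X 1 1 := mul_left_cancel₀ ha (h00.trans h11.symm)
  have hd := SL_two_det X
  rw [h01, he, zero_mul, sub_zero, mul_self_eq_one_iff] at hd
  rw [toPSL_eq_one_iff, SL_two_ext_iff, SL_two_ext_iff]
  refine hd.imp (fun h => ?_) fun h => ?_ <;> simp [h01, h10, he, h]

theorem eq_zero_of_toPSL_pow_eq_one {X : SL(2, F)} {n : ℕ} {a b : F} (h1 : toPSL F X ≠ 1)
    (hn : toPSL F X ^ n = 1) (h : X.1 ^ n = a • X.1 - b • 1) : a = 0 := by
  by_contra ha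
  rw [← map_pow, toPSL_eq_one_iff] at hn
  rcases hn with hn | hn
  · have h2 : (1 : Matrix (Fin 2) (Fin 2) F) = a • X.1 - b • 1 :=
      (congr_arg Subtype.val hn).symm.trans h
    exact h1 (toPSL_eq_one_of_smul_eq (b := 1 + b) ha
      (by rw [add_smul, one_smul]; nth_rw 1 [h2]; abel))
  · have h2 : (-1 : Matrix (Fin 2) (Fin 2) F) = a • X.1 - b • 1 :=
      (congr_arg Subtype.val hn).symm.trans h
    exact h1 (toPSL_eq_one_of_smul_eq (b := -1 + b) ha
      (by rw [add_smul, neg_smul, one_smul, h2]; abel))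

theorem trace_eq_zero_of_sq {X : SL(2, F)} (h1 : toPSL F X ≠ 1) (h : toPSL F X ^ 2 = 1) :
    X.1.trace = 0 :=
  eq_zero_of_toPSL_pow_eq_one h1 h (SL_two_sq X)

theorem exists_trace_eq_neg_one {x : PSL(2, F)} (h1 : x ≠ 1) (h : x ^ 3 = 1) :
    ∃ X : SL(2, F), toPSL F X = x ∧ X.1.trace = -1 := by
  obtain ⟨X, rfl⟩ := toPSL_surjective x
  have ht := eq_zero_of_toPSL_pow_eq_one h1 h (SL_two_cube X)
  rcases eq_or_eq_neg_of_sq_eq_sq _ _ ((sub_eq_zero.1 ht).trans (one_pow 2).symm) with ht | ht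
  · exact ⟨-X, toPSL_neg X, (trace_neg X.1).trans (congr_arg Neg.neg ht)⟩
  · exact ⟨X, rfl, ht⟩

theorem exists_trace_of_pow_five [CharP F 11] {x : PSL(2, F)} (h1 : x ≠ 1) (h : x ^ 5 = 1) :
    ∃ X : SL(2, F), toPSL F X = x ∧ (X.1.trace = 3 ∨ X.1.trace = 7) := by
  obtain ⟨X, rfl⟩ := toPSL_surjective x
  have h11 : (11 : F) = 0 := CharP.cast_eq_zero F 11
  have ht := eq_zero_of_toPSL_pow_eq_one h1 h (SL_two_pow_five X)
  have hf : ((X.1.trace - 3) * (X.1.trace - 7)) * ((-X.1.trace - 3) * (-X.1.trace - 7)) = 0 := by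
    linear_combination ht + (-5 * X.1.trace ^ 2 + 40) * h11
  rcases mul_eq_zero.1 hf with hf | hf
  · exact ⟨X, rfl, (mul_eq_zero.1 hf).imp sub_eq_zero.1 sub_eq_zero.1⟩
  · refine ⟨-X, toPSL_neg X, ?_⟩
    have e : (-X).1.trace = -X.1.trace := trace_neg _
    rw [e]
    exact (mul_eq_zero.1 hf).imp sub_eq_zero.1 sub_eq_zero.1

theorem exists_diagonalization {B : Matrix (Fin 2) (Fin 2) F} {l m : F} (hd : B.det = l * m)
    (ht : B.trace = l + m) (hlm : l ≠ m) :
    ∃ P : Matrix (Fin 2) (Fin 2) F, IsUnit P ∧ B * P = P * !![l, 0; 0, m] := by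
  obtain ⟨x, y, z, w, rfl⟩ : ∃ x y z w, B = !![x, y; z, w] := ⟨_, _, _, _, eta_fin_two B⟩
  rw [det_fin_two_of] at hd
  rw [trace_fin_two_of] at ht
  have hw : w = l + m - x := by linear_combination ht
  subst hw
  simp only [isUnit_iff_isUnit_det, isUnit_iff_ne_zero]
  by_cases hy : y = 0
  · subst hy
    have hx : (x - l) * (x - m) = 0 := by linear_combination -hd
    rcases mul_eq_zero.1 hx with hx | hx <;> rw [sub_eq_zero] at hx <;> subst hx
    · refine ⟨!![x - m, 0; z, 1], by simpa using sub_ne_zero.2 hlm, ?_⟩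
      ext i j
      fin_cases i <;> fin_cases j <;> simp <;> ring
    · refine ⟨!![0, x - l; 1, z], by simpa [sub_eq_zero] using hlm, ?_⟩
      ext i j
      fin_cases i <;> fin_cases j <;> simp <;> ring
  · refine ⟨!![y, y; l - x, m - x], ?_, ?_⟩
    · rw [det_fin_two_of, ← mul_sub]
      exact mul_ne_zero hy (by simpa [sub_eq_zero] using hlm.symm)
    · ext i j
      fin_cases i <;> fin_cases j <;> simp <;>
        first | ring1 | linear_combination -hd

theorem trace_nonsing_inv_conj {P : Matrix (Fin 2) (Fin 2) F} (hP : IsUnit P)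
    (A : Matrix (Fin 2) (Fin 2) F) : (P⁻¹ * A * P).trace = A.trace := by
  rw [Matrix.mul_assoc, trace_mul_comm, Matrix.mul_assoc,
    mul_nonsing_inv _ ((isUnit_iff_isUnit_det P).1 hP), Matrix.mul_one]

/-- The normal form, up to conjugation, of a triple of matrices with the traces imposed by the
relators of `Δ`, where `B` has eigenvalues `l` and `m`. -/
theorem exists_normal_form {A B C : Matrix (Fin 2) (Fin 2) F} {l m a c d : F}
    (hlm : l ≠ m) (hm : l * m = 1) (hl : l * a + m * d = 0) (had : a + d = -1)
    (hc : c = a * d - 1) (hc0 : c ≠ 0)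
    (dA : A.det = 1) (dB : B.det = 1) (dC : C.det = 1)
    (tA : A.trace = -1) (tB : B.trace = l + m) (tC : C.trace = -1)
    (tAB : (A * B).trace = 0) (tBC : (B * C).trace = 0) (tABC : (A * B * C).trace = 0) :
    ∃ (P : Matrix (Fin 2) (Fin 2) F) (q r : F), IsUnit P ∧ q * r = c ∧
      l * c * q + m * r + l * a ^ 2 + m * d ^ 2 = 0 ∧
      A * P = P * !![a, 1; c, d] ∧ B * P = P * !![l, 0; 0, m] ∧ C * P = P * !![a, q; r, d] := by
  obtain ⟨Q, hQ, hB⟩ := exists_diagonalization (dB.trans hm.symm) tB hlm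
  have hQd : IsUnit Q.det := (isUnit_iff_isUnit_det Q).1 hQ
  have hQB : Q⁻¹ * B * Q = !![l, 0; 0, m] := by
    rw [Matrix.mul_assoc, hB, ← Matrix.mul_assoc, nonsing_inv_mul _ hQd, Matrix.one_mul]
  have hmul (X Y : Matrix (Fin 2) (Fin 2) F) :
      Q⁻¹ * (X * Y) * Q = (Q⁻¹ * X * Q) * (Q⁻¹ * Y * Q) := by
    simp only [Matrix.mul_assoc, mul_nonsing_inv_cancel_left _ _ hQd]
  rw [← det_conj' hQ] at dA dC
  rw [← trace_nonsing_inv_conj hQ] at tA tC tAB tBC tABC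
  rw [hmul, hQB] at tAB tBC
  rw [hmul, hmul, hQB] at tABC
  have hA : A * Q = Q * (Q⁻¹ * A * Q) := by
    simp only [Matrix.mul_assoc, mul_nonsing_inv_cancel_left _ _ hQd]
  have hC : C * Q = Q * (Q⁻¹ * C * Q) := by
    simp only [Matrix.mul_assoc, mul_nonsing_inv_cancel_left _ _ hQd]
  obtain ⟨a₁, b, c₁, d₁, eA⟩ : ∃ x y z w, Q⁻¹ * A * Q = !![x, y; z, w] :=
    ⟨_, _, _, _, eta_fin_two _⟩
  obtain ⟨a₂, q, r, d₂, eC⟩ : ∃ x y z w, Q⁻¹ * C * Q = !![x, y; z, w] :=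
    ⟨_, _, _, _, eta_fin_two _⟩
  rw [eA] at dA tA tAB tABC hA
  rw [eC] at dC tC tBC tABC hC
  simp [det_fin_two_of, trace_fin_two_of] at dA dC tA tC tAB tBC tABC
  have key {x y : F} (h1 : x + y = -1) (h2 : l * x + m * y = 0) : x = a ∧ y = d := by
    have hx : x = a := by
      refine mul_left_cancel₀ (sub_ne_zero.2 hlm) ?_
      linear_combination h2 - hl - m * h1 + m * had
    exact ⟨hx, by linear_combination h1 - had - hx⟩
  obtain ⟨rfl, rfl⟩ := key tA (by linear_combination tAB)
  obtain ⟨rfl, rfl⟩ := key tC (by linear_combination tBC)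
  have hb : b ≠ 0 := fun hb => hc0 (by rw [hc]; linear_combination dA + c₁ * hb)
  obtain rfl : c = b * c₁ := by linear_combination hc + dA
  refine ⟨Q * !![b, 0; 0, 1], q / b, r * b, hQ.mul ?_, ?_, ?_, ?_, ?_, ?_⟩
  · simpa [isUnit_iff_isUnit_det] using hb
  · field_simp
    linear_combination dA - dC
  · field_simp
    linear_combination tABC
  · rw [← Matrix.mul_assoc, hA, Matrix.mul_assoc, Matrix.mul_assoc]
    congr 1
    ext i j
    fin_cases i <;> fin_cases j <;> simp <;> field_simp
  · rw [← Matrix.mul_assoc, hB, Matrix.mul_assoc, Matrix.mul_assoc]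
    congr 1
    ext i j
    fin_cases i <;> fin_cases j <;> simp [mul_comm]
  · rw [← Matrix.mul_assoc, hC, Matrix.mul_assoc, Matrix.mul_assoc]
    congr 1
    ext i j
    fin_cases i <;> fin_cases j <;> simp <;> field_simp

end General

/-- A representation of `Δ` in `PSL(2, K)` from matrices satisfying the relators up to sign. -/
def tetHom {K : Type*} [Field K] (A B C : SL(2, K)) (hA : A ^ 3 = 1) (hB : B ^ 5 = 1)
    (hC : C ^ 3 = 1) (hAB : (A * B) ^ 2 = -1) (hBC : (B * C) ^ 2 = -1)
    (hABC : (A * B * C) ^ 2 = -1) : Tet →* PSL(2, K) :=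
  PresentedGroup.toGroup (f := fun i => toPSL K (![A, B, C] i)) (by
    have h : toPSL K (-1) = 1 := toPSL_eq_one_iff.2 (Or.inr rfl)
    rintro r (rfl | rfl | rfl | rfl | rfl | rfl) <;>
      simp only [map_pow, map_mul, FreeGroup.lift_apply_of] <;>
      simp only [← map_pow, ← map_mul]
    · exact (congr_arg _ hA).trans (map_one _)
    · exact (congr_arg _ hB).trans (map_one _)
    · exact (congr_arg _ hC).trans (map_one _)
    · exact (congr_arg _ hAB).trans h
    · exact (congr_arg _ hBC).trans h
    · exact (congr_arg _ hABC).trans h)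

section TetHom

variable {K : Type*} [Field K] {A B C : SL(2, K)} {hA : A ^ 3 = 1} {hB : B ^ 5 = 1}
    {hC : C ^ 3 = 1} {hAB : (A * B) ^ 2 = -1} {hBC : (B * C) ^ 2 = -1}
    {hABC : (A * B * C) ^ 2 = -1}

theorem tetHom_of (i : Fin 3) :
    tetHom A B C hA hB hC hAB hBC hABC (PresentedGroup.of i) = toPSL K (![A, B, C] i) :=
  PresentedGroup.toGroup.of _

theorem tetHom_surjective
    (h : ∀ H : Subgroup SL(2, K), A ∈ H → B ∈ H → C ∈ H →
      (∀ c : K, Matrix.SpecialLinearGroup.transvection (zero_ne_one' (Fin 2)) c ∈ H) ∧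
        ∀ c : K, Matrix.SpecialLinearGroup.transvection (zero_ne_one' (Fin 2)).symm c ∈ H) :
    Function.Surjective (tetHom A B C hA hB hC hAB hBC hABC) := by
  obtain ⟨h₀₁, h₁₀⟩ := h ((tetHom A B C hA hB hC hAB hBC hABC).range.comap (toPSL K))
    ⟨_, tetHom_of 0⟩ ⟨_, tetHom_of 1⟩ ⟨_, tetHom_of 2⟩
  intro y
  obtain ⟨Y, rfl⟩ := toPSL_surjective y
  refine SL2.transvection_induction
    (· ∈ (tetHom A B C hA hB hC hAB hBC hABC).range.comap (toPSL K))
    (fun i j hij c => ?_) (fun _ _ => mul_mem) Y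
  fin_cases i <;> fin_cases j
  · exact absurd rfl hij
  · exact h₀₁ c
  · exact h₁₀ c
  · exact absurd rfl hij

end TetHom

/-- The set of `c` for which the transvection with coefficient `c` lies in `H`. -/
def transvectionCoeffs {K : Type*} [CommRing K] (H : Subgroup SL(2, K)) {i j : Fin 2}
    (hij : i ≠ j) : AddSubgroup K where
  carrier := {c | Matrix.SpecialLinearGroup.transvection hij c ∈ H}
  add_mem' {a b} ha hb := by
    change Matrix.SpecialLinearGroup.transvection hij (a + b) ∈ H
    rw [Matrix.SpecialLinearGroup.transvection_add]
    exact mul_mem ha hb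
  zero_mem' := by
    change Matrix.SpecialLinearGroup.transvection hij 0 ∈ H
    rw [Matrix.SpecialLinearGroup.transvection_coeff_zero]
    exact one_mem H
  neg_mem' {a} ha := by
    change Matrix.SpecialLinearGroup.transvection hij (-a) ∈ H
    rw [← Matrix.SpecialLinearGroup.transvection_inv]
    exact inv_mem ha

theorem mem_transvectionCoeffs {K : Type*} [CommRing K] {H : Subgroup SL(2, K)} {i j : Fin 2}
    {hij : i ≠ j} {c : K} {X : SL(2, K)} (hX : X ∈ H)
    (h : X = Matrix.SpecialLinearGroup.transvection hij c) : c ∈ transvectionCoeffs H hij := by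
  subst h
  exact hX

/-- A matrix representing the image of `α` in `PSL(2, 11)`. -/
def A₁₁ : SL(2, ZMod 11) := ⟨!![7, 1; 9, 3], by decide⟩
/-- A matrix representing the image of `β` in `PSL(2, 11)`. -/
def B₁₁ : SL(2, ZMod 11) := ⟨!![3, 0; 0, 4], by decide⟩
/-- A matrix representing the image of `γ` in `PSL(2, 11)`. -/
def C₁₁ : SL(2, ZMod 11) := ⟨!![7, 7; 6, 3], by decide⟩

/-- The surjection `Δ → PSL(2, 11)`. -/
def tetHom₁₁ : Tet →* PSL(2, ZMod 11) :=
  tetHom A₁₁ B₁₁ C₁₁ (by decide) (by decide) (by decide) (by decide) (by decide) (by decide)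

theorem tetHom₁₁_surjective : Function.Surjective tetHom₁₁ := by
  refine tetHom_surjective fun H hA hB hC => ?_
  have h₀₁ : (1 : ZMod 11) ∈ transvectionCoeffs H (zero_ne_one' (Fin 2)) :=
    mem_transvectionCoeffs (X :=
      C₁₁ * C₁₁ * B₁₁ * B₁₁ * C₁₁ * C₁₁ * A₁₁)
      (by repeat' apply mul_mem
          all_goals assumption) (by decide)
  have h₁₀ : (1 : ZMod 11) ∈ transvectionCoeffs H (zero_ne_one' (Fin 2)).symm :=
    mem_transvectionCoeffs (X :=
      A₁₁ * C₁₁ * A₁₁ * B₁₁ * A₁₁ * A₁₁ * C₁₁ * A₁₁)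
      (by repeat' apply mul_mem
          all_goals assumption) (by decide)
  have hc (c : ZMod 11) : c = c.val • 1 := by simp
  refine ⟨fun c => ?_, fun c => ?_⟩ <;> rw [hc c]
  · exact nsmul_mem h₀₁ _
  · exact nsmul_mem h₁₀ _

/-- The field with `121` elements, generated by a root of `X² - 10X - 7`. -/
abbrev F₁₂₁ : Type := QuadraticAlgebra (ZMod 11) 7 10

instance : Fact (∀ r : ZMod 11, r ^ 2 ≠ 7 + 10 * r) := ⟨by decide⟩

instance : Finite F₁₂₁ := .of_equiv _ (QuadraticAlgebra.equivProd _ _).symm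

theorem card_F₁₂₁ : Nat.card F₁₂₁ = 121 := by
  rw [Nat.card_congr (QuadraticAlgebra.equivProd _ _), Nat.card_prod, Nat.card_zmod]

/-- A matrix representing the image of `α` in `PSL(2, 121)`. -/
def A₁₂₁ : SL(2, F₁₂₁) := ⟨!![6, 1; 1, 4], by decide⟩
/-- A matrix representing the image of `β` in `PSL(2, 121)`. -/
def B₁₂₁ : SL(2, F₁₂₁) := ⟨!![5, 0; 0, 9], by decide⟩
/-- A matrix representing the image of `γ` in `PSL(2, 121)`. -/
def C₁₂₁ : SL(2, F₁₂₁) := ⟨!![6, .omega; 8 + 8 * .omega, 4], by decide⟩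

/-- The surjection `Δ → PSL(2, 121)`. -/
def tetHom₁₂₁ : Tet →* PSL(2, F₁₂₁) :=
  tetHom A₁₂₁ B₁₂₁ C₁₂₁ (by decide) (by decide) (by decide) (by decide) (by decide) (by decide)

theorem tetHom₁₂₁_surjective : Function.Surjective tetHom₁₂₁ := by
  refine tetHom_surjective fun H hA hB hC => ?_
  have h₀₁ : (1 : F₁₂₁) ∈ transvectionCoeffs H (zero_ne_one' (Fin 2)) :=
    mem_transvectionCoeffs (X :=
      B₁₂₁ * A₁₂₁ * C₁₂₁ * A₁₂₁ * C₁₂₁ * B₁₂₁ * A₁₂₁ * A₁₂₁ * C₁₂₁ * B₁₂₁ * B₁₂₁ * A₁₂₁ *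
      C₁₂₁ * B₁₂₁ * B₁₂₁ * B₁₂₁ * A₁₂₁ * C₁₂₁ * B₁₂₁ * A₁₂₁ * C₁₂₁)
      (by repeat' apply mul_mem
          all_goals assumption) (by decide +kernel)
  have h₀₁' : (.omega : F₁₂₁) ∈ transvectionCoeffs H (zero_ne_one' (Fin 2)) :=
    mem_transvectionCoeffs (X :=
      A₁₂₁ * B₁₂₁ * C₁₂₁ * B₁₂₁ * B₁₂₁ * C₁₂₁ * C₁₂₁ * A₁₂₁ * C₁₂₁ * B₁₂₁ * A₁₂₁ * C₁₂₁ *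
      A₁₂₁ * C₁₂₁ * A₁₂₁ * A₁₂₁ * C₁₂₁ * B₁₂₁ * B₁₂₁ * A₁₂₁ * C₁₂₁ * B₁₂₁ * B₁₂₁)
      (by repeat' apply mul_mem
          all_goals assumption) (by decide +kernel)
  have h₁₀ : (1 : F₁₂₁) ∈ transvectionCoeffs H (zero_ne_one' (Fin 2)).symm :=
    mem_transvectionCoeffs (X :=
      B₁₂₁ * B₁₂₁ * A₁₂₁ * C₁₂₁ * B₁₂₁ * A₁₂₁ * A₁₂₁ * C₁₂₁ * B₁₂₁ * A₁₂₁ * C₁₂₁ * A₁₂₁ *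
      C₁₂₁ * B₁₂₁ * A₁₂₁ * C₁₂₁ * A₁₂₁ * A₁₂₁ * B₁₂₁ * B₁₂₁ * A₁₂₁ * B₁₂₁ * C₁₂₁)
      (by repeat' apply mul_mem
          all_goals assumption) (by decide +kernel)
  have h₁₀' : (.omega : F₁₂₁) ∈ transvectionCoeffs H (zero_ne_one' (Fin 2)).symm :=
    mem_transvectionCoeffs (X :=
      C₁₂₁ * A₁₂₁ * A₁₂₁ * C₁₂₁ * B₁₂₁ * A₁₂₁ * C₁₂₁ * A₁₂₁ * C₁₂₁ * B₁₂₁ * A₁₂₁ * A₁₂₁ *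
      C₁₂₁ * B₁₂₁ * B₁₂₁ * A₁₂₁ * C₁₂₁ * B₁₂₁ * B₁₂₁ * A₁₂₁)
      (by repeat' apply mul_mem
          all_goals assumption) (by decide +kernel)
  have hc (c : F₁₂₁) : c = c.re.val • 1 + c.im.val • .omega := by
    ext <;> simp [-ZMod.natCast_val, ZMod.natCast_zmod_val]
  refine ⟨fun c => ?_, fun c => ?_⟩ <;> rw [hc c]
  · exact add_mem (nsmul_mem h₀₁ _) (nsmul_mem h₀₁' _)
  · exact add_mem (nsmul_mem h₁₀ _) (nsmul_mem h₁₀' _)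

section Classification

variable {F : Type*} [Field F]

theorem tet_relations :
    (PresentedGroup.of 0 : Tet) ^ 3 = 1 ∧ (PresentedGroup.of 1 : Tet) ^ 5 = 1 ∧
    (PresentedGroup.of 2 : Tet) ^ 3 = 1 ∧
    (PresentedGroup.of 0 * PresentedGroup.of 1 : Tet) ^ 2 = 1 ∧
    (PresentedGroup.of 1 * PresentedGroup.of 2 : Tet) ^ 2 = 1 ∧
    (PresentedGroup.of 0 * PresentedGroup.of 1 * PresentedGroup.of 2 : Tet) ^ 2 = 1 := by
  refine ⟨?_, ?_, ?_, ?_, ?_, ?_⟩ <;>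
    exact PresentedGroup.one_of_mem (by simp [tetRelators])

theorem eq_one_of_pow_eq_one_of_coprime {G : Type*} [Group G] {x : G} {m n : ℕ}
    (h : m.Coprime n) (hm : x ^ m = 1) (hn : x ^ n = 1) : x = 1 := by
  rw [← pow_one x, ← h.gcd_eq_one]
  exact pow_gcd_eq_one.2 ⟨hm, hn⟩

/-- In a nontrivial image of `Δ`, none of the elements occurring in the relators is trivial. -/
theorem ne_one_of_relations {G : Type*} [Group G] {a b c : G} (ha : a ^ 3 = 1) (hb : b ^ 5 = 1)
    (hc : c ^ 3 = 1) (hab : (a * b) ^ 2 = 1) (hbc : (b * c) ^ 2 = 1) (habc : (a * b * c) ^ 2 = 1)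
    (h : ¬(a = 1 ∧ b = 1 ∧ c = 1)) :
    a ≠ 1 ∧ b ≠ 1 ∧ c ≠ 1 ∧ a * b ≠ 1 ∧ b * c ≠ 1 ∧ a * b * c ≠ 1 := by
  have hb1 : b ≠ 1 := by
    rintro rfl
    rw [mul_one] at hab
    rw [one_mul] at hbc
    exact h ⟨eq_one_of_pow_eq_one_of_coprime (by norm_num) ha hab, rfl,
      eq_one_of_pow_eq_one_of_coprime (by norm_num) hc hbc⟩
  have hab1 : a * b ≠ 1 := fun e => hb1 <| by
    rw [eq_inv_of_mul_eq_one_left e, inv_pow, inv_eq_one] at ha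
    exact eq_one_of_pow_eq_one_of_coprime (by norm_num) hb ha
  have hbc1 : b * c ≠ 1 := fun e => hb1 <| by
    rw [eq_inv_of_mul_eq_one_right e, inv_pow, inv_eq_one] at hc
    exact eq_one_of_pow_eq_one_of_coprime (by norm_num) hb hc
  have hc1 : c ≠ 1 := by
    rintro rfl
    rw [mul_one] at hbc
    exact hb1 (eq_one_of_pow_eq_one_of_coprime (by norm_num) hb hbc)
  refine ⟨?_, hb1, hc1, hab1, hbc1, fun e => hc1 ?_⟩
  · rintro rfl
    rw [one_mul] at hab
    exact hb1 (eq_one_of_pow_eq_one_of_coprime (by norm_num) hb hab)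
  · rw [eq_inv_of_mul_eq_one_left e, inv_pow, inv_eq_one] at hab
    exact eq_one_of_pow_eq_one_of_coprime (by norm_num) hc hab

/-- Up to conjugation and base change, the only nontrivial homomorphisms from `Δ` to `PSL(2, F)` in
characteristic `11` are `tetHom₁₁` and `tetHom₁₂₁`. -/
theorem tet_classification [Algebra (ZMod 11) F] (f : Tet →* PSL(2, F)) (hf : f ≠ 1) :
    ∃ P : Matrix (Fin 2) (Fin 2) F, IsUnit P ∧
      ((∀ x, Intertwines (algebraMap (ZMod 11) F) P tetHom₁₁ f x) ∨
        ∃ φ : F₁₂₁ →+* F, ∀ x, Intertwines φ P tetHom₁₂₁ f x) := by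
  have : CharP F 11 := (Algebra.charP_iff (ZMod 11) F 11).1 inferInstance
  have h11 : (11 : F) = 0 := CharP.cast_eq_zero F 11
  have hne {n : ℕ} (h : ¬ 11 ∣ n) : (n : F) ≠ 0 :=
    fun h0 => h ((CharP.cast_eq_zero_iff F 11 n).1 h0)
  have h1 : ¬(f (.of 0) = 1 ∧ f (.of 1) = 1 ∧ f (.of 2) = 1) := fun h => hf <| by
    refine PresentedGroup.ext fun i => ?_
    fin_cases i
    exacts [h.1, h.2.1, h.2.2]
  have hr := tet_relations
  have hrel {x : Tet} {n : ℕ} (h : x ^ n = 1) : f x ^ n = 1 := by rw [← map_pow, h, map_one]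
  have ha := hrel hr.1
  have hb := hrel hr.2.1
  have hc := hrel hr.2.2.1
  have hab := hrel hr.2.2.2.1
  have hbc := hrel hr.2.2.2.2.1
  have habc := hrel hr.2.2.2.2.2
  simp only [map_mul] at hab hbc habc
  obtain ⟨ha1, hb1, hc1, hab1, hbc1, habc1⟩ := ne_one_of_relations ha hb hc hab hbc habc h1
  obtain ⟨A, hA, tA⟩ := exists_trace_eq_neg_one ha1 ha
  obtain ⟨B, hB, tB⟩ := exists_trace_of_pow_five hb1 hb
  obtain ⟨C, hC, tC⟩ := exists_trace_eq_neg_one hc1 hc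
  rw [← hA, ← hB, ← hC, ← map_mul, ← map_mul] at habc habc1
  rw [← hA, ← hB, ← map_mul] at hab hab1
  rw [← hB, ← hC, ← map_mul] at hbc hbc1
  have tAB := trace_eq_zero_of_sq hab1 hab
  have tBC := trace_eq_zero_of_sq hbc1 hbc
  have tABC := trace_eq_zero_of_sq habc1 habc
  rcases tB with tB | tB
  · obtain ⟨P, q, r, hP, hqr, hq, eA, eB, eC⟩ := exists_normal_form (l := 5) (m := 9) (a := 6)
      (d := 4) (c := 1)
      (fun h => hne (n := 4) (by norm_num) (by push_cast; linear_combination -h))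
      (by linear_combination 4 * h11) (by linear_combination 6 * h11) (by linear_combination h11)
      (by linear_combination -2 * h11) one_ne_zero A.2 B.2 C.2 tA
      (by linear_combination tB - h11) tC tAB tBC tABC
    have hr : r = 8 + 8 * q := by
      linear_combination 5 * hq + (-4 * r - 3 * q - 148) * h11
    have hq : q * q = (7 : ZMod 11) • 1 + (10 : ZMod 11) • q := by
      simp only [Algebra.smul_def, map_ofNat, mul_one]
      linear_combination 7 * hqr - 7 * q * hr - (5 * q ^ 2 + 6 * q) * h11
    let φ : F₁₂₁ →ₐ[ZMod 11] F := QuadraticAlgebra.lift ⟨q, hq⟩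
    have hφ : φ .omega = q := by simp [φ]
    have hn (n : ℕ) [n.AtLeastTwo] : φ ofNat(n) = ofNat(n) := map_ofNat φ n
    refine ⟨P, hP, Or.inr ⟨φ, Intertwines.of_generators fun i => ?_⟩⟩
    fin_cases i
    · refine ⟨A₁₂₁, A, (tetHom_of 0).symm, hA,
        eA.trans (congr_arg (P * ·) (.trans ?_ (map_SL_two_mk _ _).symm))⟩
      simp [hn]
    · refine ⟨B₁₂₁, B, (tetHom_of 1).symm, hB,
        eB.trans (congr_arg (P * ·) (.trans ?_ (map_SL_two_mk _ _).symm))⟩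
      simp [hn]
    · refine ⟨C₁₂₁, C, (tetHom_of 2).symm, hC,
        eC.trans (congr_arg (P * ·) (.trans ?_ (map_SL_two_mk _ _).symm))⟩
      simp [hφ, hr, hn]
  · obtain ⟨P, q, r, hP, hqr, hq, eA, eB, eC⟩ := exists_normal_form (l := 3) (m := 4) (a := 7)
      (d := 3) (c := 9)
      (fun h => one_ne_zero (α := F) (by linear_combination -h))
      (by linear_combination h11) (by linear_combination 3 * h11) (by linear_combination h11)
      (by linear_combination -h11) (hne (n := 9) (by norm_num)) A.2 B.2 C.2 tA
      (by linear_combination tB) tC tAB tBC tABC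
    have hq7 : q = 7 := by
      have h : (q - 7) ^ 2 = 0 := by
        linear_combination 9 * q * hq - 36 * hqr - (22 * q ^ 2 + 151 * q + 25) * h11
      exact sub_eq_zero.1 (pow_eq_zero_iff two_ne_zero |>.1 h)
    have hr6 : r = 6 := by
      linear_combination 3 * hq - 81 * hq7 - (r + 102) * h11
    have hn (n : ℕ) [n.AtLeastTwo] : algebraMap (ZMod 11) F ofNat(n) = ofNat(n) := map_ofNat _ n
    refine ⟨P, hP, Or.inl (Intertwines.of_generators fun i => ?_)⟩
    fin_cases i
    · refine ⟨A₁₁, A, (tetHom_of 0).symm, hA,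
        eA.trans (congr_arg (P * ·) (.trans ?_ (map_SL_two_mk _ _).symm))⟩
      simp [hn]
    · refine ⟨B₁₁, B, (tetHom_of 1).symm, hB,
        eB.trans (congr_arg (P * ·) (.trans ?_ (map_SL_two_mk _ _).symm))⟩
      simp [hn]
    · refine ⟨C₁₁, C, (tetHom_of 2).symm, hC,
        eC.trans (congr_arg (P * ·) (.trans ?_ (map_SL_two_mk _ _).symm))⟩
      simp [hq7, hr6, hn]

/-- A surjection `Δ → PSL(2, F)` in characteristic `11` has the kernel of one of the two standard
ones, whose field of definition then surjects onto `F`. -/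
theorem ker_eq_of_surjective [Algebra (ZMod 11) F] (f : Tet →* PSL(2, F))
    (hf : Function.Surjective f) :
    (f.ker = tetHom₁₁.ker ∧ ∃ φ : ZMod 11 →+* F, Function.Bijective φ) ∨
      (f.ker = tetHom₁₂₁.ker ∧ ∃ φ : F₁₂₁ →+* F, Function.Bijective φ) := by
  have hf1 : f ≠ 1 := by
    rintro rfl
    have := PSL_two_nontrivial (F := F)
    obtain ⟨y, hy⟩ := exists_ne (1 : PSL(2, F))
    obtain ⟨x, hx⟩ := hf y
    exact hy hx.symm
  obtain ⟨P, hP, h | ⟨φ, h⟩⟩ := tet_classification f hf1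
  · exact .inl ⟨Intertwines.ker_eq hP h, _, RingHom.injective _,
      Intertwines.baseChange_surjective hP h hf⟩
  · exact .inr ⟨Intertwines.ker_eq hP h, φ, φ.injective,
      Intertwines.baseChange_surjective hP h hf⟩

end Classification

theorem isPSLQuotient_ker {K F : Type} [Field K] [Field F] (e : K ≃+* F) {ρ : Tet →* PSL(2, K)}
    (hρ : Function.Surjective ρ) : IsPSLQuotient F ρ.ker := by
  obtain ⟨m⟩ := exists_PSL_two_mulEquiv e
  exact ⟨m.toMonoidHom.comp ρ, m.surjective.comp hρ, MonoidHom.ker_mulEquiv_comp ρ m⟩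

theorem stmt_2 :
    (∃! K : Subgroup Tet, IsPSLQuotient (GaloisField 11 1) K) ∧
    (∃! K : Subgroup Tet, IsPSLQuotient (GaloisField 11 2) K) ∧
    ∀ n : ℕ, 3 ≤ n →
      ∀ K : Subgroup Tet, ¬ IsPSLQuotient (GaloisField 11 n) K := by
  have c1 : Nat.card (ZMod 11) = 11 := Nat.card_zmod 11
  have c2 := card_F₁₂₁
  refine ⟨⟨tetHom₁₁.ker, isPSLQuotient_ker (GaloisField.equivZmodP 11).symm.toRingEquiv
    tetHom₁₁_surjective, ?_⟩, ⟨tetHom₁₂₁.ker, ?_, ?_⟩, ?_⟩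
  · rintro K ⟨f, hf, rfl⟩
    rcases ker_eq_of_surjective f hf with ⟨h, -⟩ | ⟨-, φ, hφ⟩
    · exact h
    · have := Nat.card_congr (Equiv.ofBijective φ hφ)
      rw [c2, GaloisField.card 11 1 one_ne_zero] at this
      norm_num at this
  · let _ := Fintype.ofFinite F₁₂₁
    let _ := Fintype.ofFinite (GaloisField 11 2)
    exact isPSLQuotient_ker (FiniteField.ringEquivOfCardEq (by
      rw [← Nat.card_eq_fintype_card, ← Nat.card_eq_fintype_card, c2,
        GaloisField.card 11 2 two_ne_zero]
      norm_num)) tetHom₁₂₁_surjective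
  · rintro K ⟨f, hf, rfl⟩
    rcases ker_eq_of_surjective f hf with ⟨-, φ, hφ⟩ | ⟨h, -⟩
    · have := Nat.card_congr (Equiv.ofBijective φ hφ)
      rw [c1, GaloisField.card 11 2 two_ne_zero] at this
      norm_num at this
    · exact h
  · rintro n hn K ⟨f, hf, -⟩
    have hlt : 11 ^ 3 ≤ 11 ^ n := Nat.pow_le_pow_right (by norm_num) hn
    rcases ker_eq_of_surjective f hf with ⟨-, φ, hφ⟩ | ⟨-, φ, hφ⟩ <;>
    · have := Nat.card_congr (Equiv.ofBijective φ hφ)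
      rw [GaloisField.card 11 n (by omega)] at this
      omega
end
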